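/- Let G and H be simple graphs on the same finite vertex set. Then every vertex has the same degree in G as in H if and only if G can be transformed into H by a finite sequence of 2-switches. -/

import Mathlib

/-- The degree of a vertex: the number of its neighbors. -/
noncomputable def deg {V : Type*} (G : SimpleGraph V) (v : V) : ℕ :=
  (G.neighborSet v).ncard

/-- The graph resulting from deleting the edges `ac` and `bd` of `G` and adding
the edges `ad` and `bc`. -/
def switchedGraph {V : Type*} (G : SimpleGraph V) (a b c d : V) : SimpleGraph V :=
  (G.deleteEdges {s(a, c), s(b, d)}) ⊔ SimpleGraph.fromEdgeSet {s(a, d), s(b, c)}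

/-- `H` is obtained from `G` by a 2-switch on the alternating 4-cycle `a, b, c, d`:
`ac` and `bd` are edges, `ad` and `bc` are non-edges, and these pairs are swapped. -/
def IsTwoSwitch {V : Type*} (G H : SimpleGraph V) (a b c d : V) : Prop :=
  a ≠ b ∧ a ≠ c ∧ a ≠ d ∧ b ≠ c ∧ b ≠ d ∧ c ≠ d ∧
  G.Adj a c ∧ G.Adj b d ∧ ¬ G.Adj a d ∧ ¬ G.Adj b c ∧
  H = switchedGraph G a b c d

/-- `H` is obtained from `G` by performing some 2-switch. -/
def TwoSwitch {V : Type*} (G H : SimpleGraph V) : Prop :=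
  ∃ a b c d : V, IsTwoSwitch G H a b c d

section TwoSwitch

variable {V : Type*} {G H : SimpleGraph V} {a b c d : V}

lemma switchedGraph_adj {x y : V} :
    (switchedGraph G a b c d).Adj x y ↔
      (G.Adj x y ∧ ¬ s(x, y) = s(a, c) ∧ ¬ s(x, y) = s(b, d)) ∨
        ((s(x, y) = s(a, d) ∨ s(x, y) = s(b, c)) ∧ x ≠ y) := by
  simp [switchedGraph]

lemma TwoSwitch.symm (h : TwoSwitch G H) : TwoSwitch H G := by
  obtain ⟨a, b, c, d, hab, hac, had, hbc, hbd, hcd, h1, h2, h3, h4, rfl⟩ := h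
  have h1' := h1.symm
  have h2' := h2.symm
  refine ⟨a, b, d, c, hab, had, hac, hbd, hbc, hcd.symm, ?_, ?_, ?_, ?_, ?_⟩
  · simp [switchedGraph_adj, had]
  · simp [switchedGraph_adj, hbc]
  · simp only [switchedGraph_adj, Sym2.eq_iff]; grind
  · simp only [switchedGraph_adj, Sym2.eq_iff]; grind
  · ext x y
    have h3' : ¬ G.Adj d a := fun h => h3 h.symm
    have h4' : ¬ G.Adj c b := fun h => h4 h.symm
    simp only [switchedGraph_adj, Sym2.eq_iff]
    grind

lemma IsTwoSwitch.symm_pairs (h : IsTwoSwitch G H a b c d) : IsTwoSwitch G H b a d c := by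
  obtain ⟨hab, hac, had, hbc, hbd, hcd, h1, h2, h3, h4, rfl⟩ := h
  refine ⟨hab.symm, hbd, hbc, had, hac, hcd.symm, h2, h1, h4, h3, ?_⟩
  rw [switchedGraph, switchedGraph, Set.pair_comm, Set.pair_comm s(a, d)]

lemma IsTwoSwitch.symm_edges (h : IsTwoSwitch G H a b c d) : IsTwoSwitch G H c d a b := by
  obtain ⟨hab, hac, had, hbc, hbd, hcd, h1, h2, h3, h4, rfl⟩ := h
  refine ⟨hcd, hac.symm, hbc.symm, had.symm, hbd.symm, hab, h1.symm, h2.symm,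
    fun h => h4 h.symm, fun h => h3 h.symm, ?_⟩
  rw [switchedGraph, switchedGraph, Sym2.eq_swap (a := a) (b := c),
    Sym2.eq_swap (a := b) (b := d), Sym2.eq_swap (a := a) (b := d),
    Sym2.eq_swap (a := b) (b := c), Set.pair_comm s(d, a)]

lemma IsTwoSwitch.neighborSet_left (h : IsTwoSwitch G H a b c d) :
    H.neighborSet a = insert d (G.neighborSet a \ {c}) := by
  obtain ⟨hab, hac, had, hbc, hbd, hcd, h1, h2, h3, h4, rfl⟩ := h
  ext y
  simp only [SimpleGraph.mem_neighborSet, switchedGraph_adj, Sym2.eq_iff, Set.mem_insert_iff,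
    Set.mem_sdiff, Set.mem_singleton_iff]
  grind

lemma IsTwoSwitch.deg_left [Finite V] (h : IsTwoSwitch G H a b c d) : deg G a = deg H a := by
  rw [deg, deg, h.neighborSet_left]
  obtain ⟨hab, hac, had, hbc, hbd, hcd, h1, h2, h3, h4, rfl⟩ := h
  exact (Set.ncard_exchange h3 h1).symm

lemma TwoSwitch.deg_eq [Finite V] (h : TwoSwitch G H) (v : V) : deg G v = deg H v := by
  obtain ⟨a, b, c, d, h⟩ := h
  by_cases ha : v = a
  · exact ha ▸ h.deg_left
  by_cases hb : v = b
  · exact hb ▸ h.symm_pairs.deg_left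
  by_cases hc : v = c
  · exact hc ▸ h.symm_edges.deg_left
  by_cases hd : v = d
  · exact hd ▸ h.symm_edges.symm_pairs.deg_left
  obtain ⟨hab, hac, had, hbc, hbd, hcd, h1, h2, h3, h4, rfl⟩ := h
  have : (switchedGraph G a b c d).neighborSet v = G.neighborSet v := by
    ext y
    simp only [SimpleGraph.mem_neighborSet, switchedGraph_adj, Sym2.eq_iff]
    grind
  rw [deg, deg, this]

lemma deg_eq_of_reflTransGen [Finite V] (h : Relation.ReflTransGen TwoSwitch G H) (v : V) :
    deg G v = deg H v := by
  induction h with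
  | refl => rfl
  | tail _ h ih => exact ih.trans (h.deg_eq v)

/-- `G` and `H` have the same edges, except possibly for edges inside `T`. -/
def AgreeOutside (T : Set V) (G H : SimpleGraph V) : Prop :=
  ∀ x y, ¬ (x ∈ T ∧ y ∈ T) → (G.Adj x y ↔ H.Adj x y)

lemma AgreeOutside.symm {T : Set V} (h : AgreeOutside T G H) : AgreeOutside T H G :=
  fun x y hxy => (h x y hxy).symm

/-- Graphs with equal degrees that agree outside `T` also have equal degrees inside `T`. -/
lemma AgreeOutside.ncard_inter_eq [Finite V] {T : Set V} (h : AgreeOutside T G H) {x : V}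
    (hx : deg G x = deg H x) :
    (G.neighborSet x ∩ T).ncard = (H.neighborSet x ∩ T).ncard := by
  have hG := Set.ncard_inter_add_ncard_sdiff_eq_ncard (G.neighborSet x) T (Set.toFinite _)
  have hH := Set.ncard_inter_add_ncard_sdiff_eq_ncard (H.neighborSet x) T (Set.toFinite _)
  have : G.neighborSet x \ T = H.neighborSet x \ T := by
    ext y
    simp only [Set.mem_sdiff, SimpleGraph.mem_neighborSet]
    exact and_congr_left fun hy => h x y fun hxy => hy hxy.2
  simp only [deg] at hx
  rw [this] at hG
  omega

/-- If `u` has at least as many neighbors in `T` as `w`, and `v ∈ T` is adjacent to `w` but not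
to `u`, then some vertex of `T` is adjacent to `u` but not to `w`. -/
lemma exists_adj_not_adj_of_ncard_le [Finite V] {T : Set V} {u v w : V} (hu : u ∈ T) (hv : v ∈ T)
    (hw : w ∈ T) (huv : u ≠ v) (hvw : G.Adj v w) (hvu : ¬ G.Adj v u)
    (hle : (G.neighborSet w ∩ T).ncard ≤ (G.neighborSet u ∩ T).ncard) :
    ∃ z ∈ T, z ≠ w ∧ G.Adj u z ∧ ¬ G.Adj w z := by
  by_contra! hcon
  have hsub : (G.neighborSet u ∩ T) \ {w} ⊆ (G.neighborSet w ∩ T) \ {u} := by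
    rintro z ⟨⟨hz, hzT⟩, hzw⟩
    exact ⟨⟨hcon z hzT hzw hz, hzT⟩, hz.ne'⟩
  have hlt := Set.ncard_lt_ncard (hsub.ssubset_of_mem_notMem
    (a := v) ⟨⟨hvw.symm, hv⟩, huv.symm⟩ fun h => hvu h.1.1.symm) (Set.toFinite _)
  by_cases huw : G.Adj u w
  · have h1 := Set.ncard_sdiff_singleton_add_one (s := G.neighborSet u ∩ T) (a := w) ⟨huw, hw⟩
    have h2 := Set.ncard_sdiff_singleton_add_one (s := G.neighborSet w ∩ T) (a := u) ⟨huw.symm, hu⟩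
    omega
  · rw [Set.sdiff_singleton_eq_self fun h => huw h.1,
      Set.sdiff_singleton_eq_self fun h => huw h.1.symm] at hlt
    omega

/-- A 2-switch at `v` bringing `G` closer to `H` without leaving `T`. -/
lemma exists_twoSwitch_ncard_lt [Finite V] {T : Set V} (h : AgreeOutside T G H) {u v w : V}
    (hGw : G.Adj v w) (hHw : ¬ H.Adj v w) (hGu : ¬ G.Adj v u) (hHu : H.Adj v u)
    (hle : (G.neighborSet w ∩ T).ncard ≤ (G.neighborSet u ∩ T).ncard) :
    ∃ G', TwoSwitch G G' ∧ AgreeOutside T G' H ∧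
      {x | ¬ (G'.Adj v x ↔ H.Adj v x)}.ncard < {x | ¬ (G.Adj v x ↔ H.Adj v x)}.ncard := by
  obtain ⟨hv, hw⟩ : v ∈ T ∧ w ∈ T := by
    by_contra hT
    exact hHw ((h v w hT).1 hGw)
  have hu : u ∈ T := by
    by_contra hT
    exact hGu ((h v u fun h => hT h.2).2 hHu)
  obtain ⟨z, hz, hzw, huz, hwz⟩ :=
    exists_adj_not_adj_of_ncard_le hu hv hw hHu.ne' hGw hGu hle
  have hvz : v ≠ z := by rintro rfl; exact hGu huz.symm
  have hwu : w ≠ u := by rintro rfl; exact hGu hGw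
  have hs : IsTwoSwitch G (switchedGraph G v z w u) v z w u :=
    ⟨hvz, hGw.ne, hHu.ne, hzw, huz.ne', hwu, hGw, huz.symm, hGu, fun h => hwz h.symm, rfl⟩
  refine ⟨_, ⟨v, z, w, u, hs⟩, ?_, ?_⟩
  · intro x y hxy
    rw [← h x y hxy]
    simp only [switchedGraph_adj, Sym2.eq_iff]
    grind
  · have key (x : V) : (switchedGraph G v z w u).Adj v x ↔ x = u ∨ (G.Adj v x ∧ x ≠ w) := by
      rw [← SimpleGraph.mem_neighborSet, hs.neighborSet_left]
      rfl
    refine Set.ncard_lt_ncard (Set.ssubset_iff_of_subset ?_ |>.2 ⟨w, ?_, ?_⟩) (Set.toFinite _)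
    · intro x
      simp only [Set.mem_ofPred_eq, key]
      grind
    · simp [hGw, hHw]
    · simp [key, hwu, hHw]

lemma AgreeOutside.reflTransGen [Finite V] {T : Set V} (h : AgreeOutside T G H)
    (hdeg : ∀ v, deg G v = deg H v) : Relation.ReflTransGen TwoSwitch G H := by
  induction T, Set.toFinite T using Set.Finite.induction_on generalizing G H with
  | empty =>
    have : G = H := by
      ext x y
      exact h x y (by simp)
    exact this ▸ .refl
  | @insert v T _ _ ih =>
    induction hn : {x | ¬ (G.Adj v x ↔ H.Adj v x)}.ncard using Nat.strong_induction_on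
      generalizing G H with
    | _ n ihn =>
    subst hn
    by_cases hN : G.neighborSet v = H.neighborSet v
    · refine ih (fun x y hxy => ?_) hdeg
      have hiff (y : V) : G.Adj v y ↔ H.Adj v y := Set.ext_iff.1 hN y
      by_cases hx : x = v
      · exact hx ▸ hiff y
      by_cases hy : y = v
      · rw [hy, G.adj_comm, H.adj_comm]
        exact hiff x
      exact h x y (by simpa [hx, hy] using hxy)
    · have hd := hdeg v
      simp only [deg] at hd
      obtain ⟨w, hGw, hHw⟩ := Set.not_subset.1 fun hsub =>
        hN (Set.eq_of_subset_of_ncard_le hsub hd.ge (Set.toFinite _))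
      obtain ⟨u, hHu, hGu⟩ := Set.not_subset.1 fun hsub =>
        hN (Set.eq_of_subset_of_ncard_le hsub hd.le (Set.toFinite _)).symm
      rcases le_total (G.neighborSet w ∩ insert v T).ncard
        (G.neighborSet u ∩ insert v T).ncard with hle | hle
      · obtain ⟨G', hs, hG', hlt⟩ := exists_twoSwitch_ncard_lt h hGw hHw hGu hHu hle
        exact .head hs (ihn _ hlt hG' (fun x => (hs.deg_eq x).symm.trans (hdeg x)) rfl)
      · rw [h.ncard_inter_eq (hdeg w), h.ncard_inter_eq (hdeg u)] at hle
        obtain ⟨H', hs, hH', hlt⟩ := exists_twoSwitch_ncard_lt h.symm hHu hGu hHw hGw hle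
        refine .tail (ihn _ ?_ hH'.symm (fun x => (hdeg x).trans (hs.deg_eq x)) rfl) hs.symm
        simpa only [iff_comm] using hlt

end TwoSwitch

/-- Two graphs on the same finite vertex set have the same degree at every vertex
iff one can be transformed into the other by a finite sequence of 2-switches. -/
theorem stmt4 {V : Type*} [Fintype V] (G H : SimpleGraph V) :
    (∀ v, deg G v = deg H v) ↔ Relation.ReflTransGen TwoSwitch G H :=
  ⟨AgreeOutside.reflTransGen (T := Set.univ) fun _ _ h => (h ⟨trivial, trivial⟩).elim,
    deg_eq_of_reflTransGen⟩
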